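/- arXiv:1212.6180 — 3 statements merged into one kernel-verified Lean document; each statement's English description precedes it below -/
import Mathlib

section
/- Characterization of Lie algebra automorphisms: Let α : ℝ³ → ℝ³ be a linear map written in block form with 2×2 block α₂ₓ₂, column α_{•3} ∈ ℝ², row α_{3•} ∈ (ℝ²)*, and scalar α₃₃, acting by α(v, z) = (α₂ₓ₂·v + α_{•3}·z, α_{3•}·v + α₃₃·z). Then α preserves the bracket [·,·]_M, i.e. α[u, u']_M = [α u, α u']_M for all u, u' ∈ ℝ³, if and only if the following three conditions hold: (i) α_{3•}·M = 0; (ii) α₂ₓ₂·M − α₃₃·M·α₂ₓ₂ + M·α_{•3}·α_{3•} = 0; (iii) M·α₂ₓ₂·σ·α_{3•}ᵀ = 0, where σ is the 2×2 matrix with rows (0, −1) and (1, 0). -/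
open Matrix

/-- The Bianchi Lie bracket on `ℝ² ⊕ ℝ`:
`[(v,z),(w,z')] = (z·M·w − z'·M·v, 0)`. -/
def bianchiBracket (M : Matrix (Fin 2) (Fin 2) ℝ) (u u' : (Fin 2 → ℝ) × ℝ) :
    (Fin 2 → ℝ) × ℝ :=
  (u.2 • M.mulVec u'.1 - u'.2 • M.mulVec u.1, 0)

/-- The linear map `ℝ³ → ℝ³` with blocks `A = α₂ₓ₂`, `b = α_{•3}`, `c = α_{3•}`,
`d = α₃₃`: `α(v, z) = (A·v + z·b, c·v + d·z)`. -/
def blockMap (A : Matrix (Fin 2) (Fin 2) ℝ) (b c : Fin 2 → ℝ) (d : ℝ)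
    (u : (Fin 2 → ℝ) × ℝ) : (Fin 2 → ℝ) × ℝ :=
  (A.mulVec u.1 + u.2 • b, c ⬝ᵥ u.1 + d * u.2)

/-- Characterization of Lie algebra automorphisms of the Bianchi algebra `𝔤_M`:
`α` preserves the bracket iff (i) `α_{3•}·M = 0`,
(ii) `α₂ₓ₂·M − α₃₃·M·α₂ₓ₂ + M·α_{•3}·α_{3•} = 0`, and
(iii) `M·α₂ₓ₂·σ·α_{3•}ᵀ = 0` with `σ = [[0,−1],[1,0]]`. -/
theorem bianchi_algebra_automorphism_characterization
    (M A : Matrix (Fin 2) (Fin 2) ℝ) (b c : Fin 2 → ℝ) (d : ℝ) :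
    (∀ u u' : (Fin 2 → ℝ) × ℝ,
      blockMap A b c d (bianchiBracket M u u')
        = bianchiBracket M (blockMap A b c d u) (blockMap A b c d u')) ↔
    (Matrix.vecMul c M = 0 ∧
     A * M - d • (M * A) + M * Matrix.vecMulVec b c = 0 ∧
     (M * A * !![0, -1; 1, 0]).mulVec c = 0) := by
  simp only [funext_iff, ← Matrix.ext_iff, Prod.forall, Prod.ext_iff, bianchiBracket, blockMap,
    Fin.forall_fin_two, Matrix.mulVec, Matrix.vecMul, dotProduct, Matrix.mul_apply,
    Matrix.vecMulVec_apply, Fin.sum_univ_two, Matrix.add_apply, Matrix.sub_apply,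
    Matrix.smul_apply, Matrix.zero_apply, Pi.add_apply, Pi.sub_apply, Pi.smul_apply,
    Pi.zero_apply, smul_eq_mul, Matrix.of_apply, Matrix.cons_val_zero, Matrix.cons_val_one]
  constructor
  · intro h
    obtain ⟨⟨h₁, h₂⟩, -⟩ := h ![1, 0] 0 ![0, 1] 0
    obtain ⟨⟨h₃, h₄⟩, h₅⟩ := h 0 1 ![1, 0] 0
    obtain ⟨⟨h₆, h₇⟩, h₈⟩ := h 0 1 ![0, 1] 0
    simp only [Matrix.cons_val_zero, Matrix.cons_val_one, Pi.zero_apply]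
      at h₁ h₂ h₃ h₄ h₅ h₆ h₇ h₈
    refine ⟨⟨?_, ?_⟩, ⟨⟨?_, ?_⟩, ?_, ?_⟩, ?_, ?_⟩
    · linear_combination h₅
    · linear_combination h₈
    · linear_combination h₃
    · linear_combination h₆
    · linear_combination h₄
    · linear_combination h₇
    · linear_combination -h₁
    · linear_combination -h₂
  · rintro ⟨⟨h₁, h₂⟩, ⟨⟨h₃, h₄⟩, h₅, h₆⟩, h₇, h₈⟩ v z w t
    refine ⟨⟨?_, ?_⟩, ?_⟩
    · linear_combination (z * w 0 - t * v 0) * h₃ + (z * w 1 - t * v 1) * h₄ -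
        (v 0 * w 1 - v 1 * w 0) * h₇
    · linear_combination (z * w 0 - t * v 0) * h₅ + (z * w 1 - t * v 1) * h₆ -
        (v 0 * w 1 - v 1 * w 0) * h₈
    · linear_combination (z * w 0 - t * v 0) * h₁ + (z * w 1 - t * v 1) * h₂
end

section
/- If the 2×2 matrix M is invertible, then a bijective linear map α : ℝ³ → ℝ³ (block form as above) preserves the bracket [·,·]_M if and only if α_{3•} = 0, α₃₃ ≠ 0, α₂ₓ₂ is invertible, and α₂ₓ₂·M = α₃₃·M·α₂ₓ₂ (with α_{•3} ∈ ℝ² arbitrary). -/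
open Matrix

/-- Bracket preservation restricted to pairs `(0, 1)`, `(w, 0)`. -/
theorem blockMap_bracket_axis {M A : Matrix (Fin 2) (Fin 2) ℝ} {b c : Fin 2 → ℝ} {d : ℝ}
    (h : ∀ u u' : (Fin 2 → ℝ) × ℝ,
      blockMap A b c d (bianchiBracket M u u')
        = bianchiBracket M (blockMap A b c d u) (blockMap A b c d u'))
    (w : Fin 2 → ℝ) :
    A *ᵥ (M *ᵥ w) = d • M *ᵥ (A *ᵥ w) - (c ⬝ᵥ w) • M *ᵥ b ∧ c ⬝ᵥ M *ᵥ w = 0 := by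
  simpa [blockMap, bianchiBracket, Prod.ext_iff] using h (0, 1) (w, 0)

/-- A covector vanishing on the image of an invertible matrix is zero. -/
theorem eq_zero_of_dotProduct_mulVec_eq_zero {n : Type*} [Fintype n] [DecidableEq n]
    {M : Matrix n n ℝ} (hM : IsUnit M.det) {c : n → ℝ}
    (h : ∀ w, c ⬝ᵥ M *ᵥ w = 0) : c = 0 := by
  refine dotProduct_eq_zero c fun w => ?_
  simpa [mulVec_mulVec, mul_nonsing_inv M hM] using h (M⁻¹ *ᵥ w)

theorem ne_zero_of_surjective_blockMap {A : Matrix (Fin 2) (Fin 2) ℝ} {b : Fin 2 → ℝ} {d : ℝ}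
    (h : Function.Surjective (blockMap A b 0 d)) : d ≠ 0 := by
  rintro rfl
  obtain ⟨u, hu⟩ := h (0, 1)
  simpa [blockMap] using congrArg Prod.snd hu

theorem isUnit_det_of_injective_blockMap {A : Matrix (Fin 2) (Fin 2) ℝ} {b : Fin 2 → ℝ} {d : ℝ}
    (h : Function.Injective (blockMap A b 0 d)) : IsUnit A.det := by
  rw [← isUnit_iff_isUnit_det, ← mulVec_injective_iff_isUnit]
  intro v w hvw
  have key : blockMap A b 0 d (v, 0) = blockMap A b 0 d (w, 0) := by
    simpa [blockMap] using hvw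
  exact congrArg Prod.fst (h key)

/-- If `M` is invertible, a bijective linear map `α` (in block form) preserves the
Bianchi bracket iff `α_{3•} = 0`, `α₃₃ ≠ 0`, `α₂ₓ₂` is invertible, and
`α₂ₓ₂·M = α₃₃·M·α₂ₓ₂` (with `α_{•3}` arbitrary). -/
theorem bianchi_algebra_automorphism_invertible_case
    (M : Matrix (Fin 2) (Fin 2) ℝ) (hM : IsUnit M.det)
    (A : Matrix (Fin 2) (Fin 2) ℝ) (b c : Fin 2 → ℝ) (d : ℝ)
    (hbij : Function.Bijective (blockMap A b c d)) :
    (∀ u u' : (Fin 2 → ℝ) × ℝ,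
      blockMap A b c d (bianchiBracket M u u')
        = bianchiBracket M (blockMap A b c d u) (blockMap A b c d u')) ↔
    (c = 0 ∧ d ≠ 0 ∧ IsUnit A.det ∧ A * M = d • (M * A)) := by
  constructor
  · intro h
    obtain rfl : c = 0 :=
      eq_zero_of_dotProduct_mulVec_eq_zero hM fun w => (blockMap_bracket_axis h w).2
    refine ⟨rfl, ne_zero_of_surjective_blockMap hbij.surjective,
      isUnit_det_of_injective_blockMap hbij.injective, ?_⟩
    refine mulVec_injective (funext fun w => ?_)
    simpa [← mulVec_mulVec, smul_mulVec] using (blockMap_bracket_axis h w).1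
  · rintro ⟨rfl, -, -, hAM⟩ ⟨v, z⟩ ⟨w, z'⟩
    have key (x : Fin 2 → ℝ) : A *ᵥ (M *ᵥ x) = d • M *ᵥ (A *ᵥ x) := by
      rw [mulVec_mulVec, hAM, smul_mulVec, mulVec_mulVec]
    simp only [blockMap, bianchiBracket, mulVec_sub, mulVec_add, mulVec_smul, key,
      zero_dotProduct, zero_add, mul_zero, zero_smul, add_zero, Prod.mk.injEq, and_true]
    module
end

section
/- Automorphisms map singleton representations to singleton representations: Let α be a linear map in block form (2×2 block α₂ₓ₂, column α_{•3}, row α_{3•}, scalar α₃₃) satisfying α_{3•}·M = 0 and α₂ₓ₂·M − α₃₃·M·α₂ₓ₂ + M·α_{•3}·α_{3•} = 0. If k̆ ∈ ℝ² satisfies Mᵀ·k̆ = 0, then for every k₃ ∈ ℝ one has Mᵀ·(α₂ₓ₂ᵀ·k̆ + k₃·α_{3•}ᵀ) = 0; i.e. the pullback along α of the character determined by (k̆, k₃) with k̆ in the null space V⁰ = ker Mᵀ is again determined by a vector whose ℝ²-component lies in V⁰. -/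
open Matrix

/-- Automorphisms map singleton representations to singleton representations: if
the block map `α` (blocks `A = α₂ₓ₂`, `b = α_{•3}`, `c = α_{3•}`, `d = α₃₃`)
satisfies `α_{3•}·M = 0` and `α₂ₓ₂·M − α₃₃·M·α₂ₓ₂ + M·α_{•3}·α_{3•} = 0`, and
`k̆ ∈ V⁰ = ker Mᵀ`, then for every `k₃ ∈ ℝ` the `ℝ²`-component
`α₂ₓ₂ᵀ·k̆ + k₃·α_{3•}ᵀ` of the pullback character again lies in `V⁰`. -/
theorem automorphisms_preserve_singletons
    (M A : Matrix (Fin 2) (Fin 2) ℝ) (b c : Fin 2 → ℝ) (d : ℝ)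
    (h1 : Matrix.vecMul c M = 0)
    (h2 : A * M - d • (M * A) + M * Matrix.vecMulVec b c = 0)
    (k : Fin 2 → ℝ) (hk : Mᵀ.mulVec k = 0) :
    ∀ k₃ : ℝ, Mᵀ.mulVec (Aᵀ.mulVec k + k₃ • c) = 0 := by
  intro k₃
  rw [mulVec_transpose] at hk
  have h := congrArg (fun N => k ᵥ* N) h2
  simp only [vecMul_add, vecMul_sub, vecMul_smul, ← vecMul_vecMul, hk, zero_vecMul, vecMul_zero,
    smul_zero, sub_zero, add_zero] at h
  rw [mulVec_transpose, mulVec_transpose, add_vecMul, smul_vecMul, h1, h, smul_zero, add_zero]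
end
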